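/- arXiv:2009.07051 — 4 statements merged into one kernel-verified Lean document; each statement's English description precedes it below -/
import Mathlib

section
/- Let ((P_n),(Q_n)) be a π_N-(q,ω)-coherent pair with index M and order (m,0), with m ≥ 1 whenever N = 0, let u and v be the regular functionals with respect to which (P_n) and (Q_n) are orthogonal, and let Φ(x;j) be defined by the recursion Φ(x;j) = ( ⟨v, Q_j^2⟩ ψ(x;j) − Σ_{l=0}^{j−1} [m choose l]_{q^{−1}} (L_{1/q,−ω/q}^{m−l} D_{1/q,−ω/q}^{l} Q_j)(x) Φ(x;l) ) / ( [j]_{q^{−1}}! [m choose j]_{q^{−1}} ). Then for every j = 0, 1, …, m one has D_{1/q,−ω/q}^{m−j}( π_N·v ) = Φ(·;j)·u; in particular π_N·v = Φ(·;m)·u, so that u and v are related by a rational transformation. -/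
open Polynomial Finset

noncomputable section

namespace DiscreteCoherent

/-- The Hahn operator `D_{q,ω}` acting on polynomials:
`(D_{q,ω} f)(x) = (f(qx+ω) − f(x))/((q−1)x+ω)`.
Since `(q−1)x+ω = (q−1)(x − ω/(1−q))`, the (exact) division is performed
via division by the monic polynomial `X − C (ω/(1−q))`. -/
def hahnD (q ω : ℂ) (f : Polynomial ℂ) : Polynomial ℂ :=
  (q - 1)⁻¹ • ((f.comp (C q * X + C ω) - f) /ₘ (X - C (ω / (1 - q))))

/-- The shift operator `L_{q,ω}` on polynomials: `(L_{q,ω} f)(x) = f(qx+ω)`. -/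
def shiftL (q ω : ℂ) (f : Polynomial ℂ) : Polynomial ℂ := f.comp (C q * X + C ω)

/-- Functionals on complex polynomials (linearity is assumed separately). -/
abbrev PolyFun := Polynomial ℂ → ℂ

/-- Left multiplication of a functional by a polynomial: `⟨g·u, f⟩ = ⟨u, g f⟩`. -/
def pmul (g : Polynomial ℂ) (u : PolyFun) : PolyFun := fun f => u (g * f)

/-- The operator `D_{q,ω}` on functionals: `⟨D_{q,ω} u, f⟩ = −q⁻¹ ⟨u, D_{1/q,−ω/q} f⟩`. -/
def fD (q ω : ℂ) (u : PolyFun) : PolyFun := fun f => -q⁻¹ * u (hahnD q⁻¹ (-ω / q) f)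

/-- The operator `L_{q,ω}` on functionals: `⟨L_{q,ω} u, f⟩ = ⟨u, L_{1/q,−ω/q} f⟩`. -/
def fL (q ω : ℂ) (u : PolyFun) : PolyFun := fun f => u (shiftL q⁻¹ (-ω / q) f)

/-- `[n]_q = (q^n − 1)/(q − 1)`. -/
def qNum (q : ℂ) (n : ℕ) : ℂ := (q ^ n - 1) / (q - 1)

/-- `[n]_q! = ∏_{j=1}^n [j]_q`. -/
def qFact (q : ℂ) (n : ℕ) : ℂ := ∏ j ∈ Finset.range n, qNum q (j + 1)

/-- The Gaussian binomial coefficient `[n choose k]_q`. -/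
def qBinom (q : ℂ) (n k : ℕ) : ℂ := qFact q n / (qFact q k * qFact q (n - k))

/-- `(P_n)` is the monic OPS with respect to the (regular) linear functional `u`. -/
structure IsMonicOPS (u : PolyFun) (P : ℕ → Polynomial ℂ) : Prop where
  lin : IsLinearMap ℂ u
  monic : ∀ n, (P n).Monic
  natDegree_eq : ∀ n, (P n).natDegree = n
  orth : ∀ m n, m ≠ n → u (P m * P n) = 0
  sq_ne : ∀ n, u (P n ^ 2) ≠ 0

/-- A linear functional is regular if it admits a monic OPS. -/
def IsRegular (u : PolyFun) : Prop := ∃ P, IsMonicOPS u P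

/-- The normalized discrete derivatives `P_n^{[m]} = ([n]_q!/[n+m]_q!) D_{q,ω}^m P_{n+m}`. -/
def dps (q ω : ℂ) (P : ℕ → Polynomial ℂ) (m n : ℕ) : Polynomial ℂ :=
  (qFact q n / qFact q (n + m)) • ((hahnD q ω)^[m] (P (n + m)))

/-- `((P_n),(Q_n))` is a `π_N`-`(q,ω)`-coherent pair with index `M` and order `(m,k)`,
with coefficients `c`.  The convention `Q_j ≡ 0` for `j < 0` is realized by the
truncated subtraction `n - M` in the lower summation limit. -/
structure IsCoherentPair (q ω : ℂ) (P Q : ℕ → Polynomial ℂ) (piN : Polynomial ℂ)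
    (M N m k : ℕ) (c : ℕ → ℕ → ℂ) : Prop where
  monic_pi : piN.Monic
  natDegree_pi : piN.natDegree = N
  struct : ∀ n, piN * dps q ω P m n =
    ∑ j ∈ Finset.Icc (n - M) (n + N), c n j • dps q ω Q k j
  lead : ∀ n, c n (n + N) = 1
  coeff_ne : ∀ n, M ≤ n → c n (n - M) ≠ 0

/-- The polynomial `ψ(·;n)`; terms with negative indices are omitted (truncated
subtraction in the lower summation limit). -/
def psiP (q : ℂ) (u : PolyFun) (P : ℕ → Polynomial ℂ) (c : ℕ → ℕ → ℂ)
    (M N m : ℕ) (n : ℕ) : Polynomial ℂ :=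
  ∑ j ∈ Finset.Icc (n - N) (n + M),
    ((-q) ^ m * qFact q (j + m) / (qFact q j * u (P (m + j) ^ 2)) * c j n) • P (m + j)

/-- The polynomial `φ(·;n,j)`. -/
def phiP (q ω : ℂ) (v : PolyFun) (Q : ℕ → Polynomial ℂ) (piN : Polynomial ℂ)
    (N k : ℕ) (n j : ℕ) : Polynomial ℂ :=
  ((-q) ^ k * qFact q (n + k) / (qFact q n * v (Q (n + k) ^ 2))) •
    ∑ l ∈ Finset.range (N - j + 1),
      (qBinom q⁻¹ (k + n) l * qBinom q⁻¹ (N - l) (N - j - l)) •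
        ((shiftL q⁻¹ (-ω / q))^[k + N - l] ((hahnD q⁻¹ (-ω / q))^[l] piN) *
          (shiftL q⁻¹ (-ω / q))^[j] ((hahnD q⁻¹ (-ω / q))^[n - j - l] (Q (n + k))))

/-- `u` is a `D_{q,ω}`-semiclassical functional. -/
def IsSemiclassical (q ω : ℂ) (u : PolyFun) : Prop :=
  ∃ phi psi : Polynomial ℂ, phi ≠ 0 ∧ psi ≠ 0 ∧ 1 ≤ psi.natDegree ∧
    fD q ω (pmul phi u) = pmul psi u

/-- The class `s(u)` of a `D_{q,ω}`-semiclassical functional. -/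
def semiClass (q ω : ℂ) (u : PolyFun) : ℕ :=
  sInf {s | ∃ phi psi : Polynomial ℂ, phi ≠ 0 ∧ psi ≠ 0 ∧ 1 ≤ psi.natDegree ∧
    fD q ω (pmul phi u) = pmul psi u ∧
    max (phi.natDegree - 2) (psi.natDegree - 1) = s}

end DiscreteCoherent
namespace DiscreteCoherent

/-- `hahnD` is an exact division. -/
theorem hahnD_spec {q : ℂ} (hq1 : q ≠ 1) (ω : ℂ) (f : Polynomial ℂ) :
    (C (q - 1) * X + C ω) * hahnD q ω f = shiftL q ω f - f := by
  have h1 : q - 1 ≠ 0 := sub_ne_zero.mpr hq1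
  have h1' : 1 - q ≠ 0 := sub_ne_zero.mpr hq1.symm
  have hroot : (f.comp (C q * X + C ω) - f).IsRoot (ω / (1 - q)) := by
    have : q * (ω / (1 - q)) + ω = ω / (1 - q) := by field_simp; ring
    simp [IsRoot, eval_comp, this]
  have hlin : C (q - 1) * X + C ω = C (q - 1) * (X - C (ω / (1 - q))) := by
    have : ω = -((q - 1) * (ω / (1 - q))) := by field_simp; ring
    rw [mul_sub, ← C_mul, sub_eq_add_neg _ (C _), ← C_neg, ← this]
  have hinv : C (q - 1) * C (q - 1)⁻¹ = (1 : Polynomial ℂ) := by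
    rw [← C_mul, mul_inv_cancel₀ h1, C_1]
  rw [hlin, hahnD, shiftL, smul_eq_C_mul]
  calc _ = (C (q - 1) * C (q - 1)⁻¹) * ((X - C (ω / (1 - q))) *
        ((f.comp (C q * X + C ω) - f) /ₘ (X - C (ω / (1 - q))))) := by ring
    _ = _ := by rw [hinv, one_mul, mul_divByMonic_eq_iff_isRoot.mpr hroot]

theorem hahnD_denom_ne_zero {q : ℂ} (hq1 : q ≠ 1) (ω : ℂ) :
    (C (q - 1) * X + C ω : Polynomial ℂ) ≠ 0 := fun h => by
  have := congrArg (fun p => coeff p 1) h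
  simp [coeff_C, sub_eq_zero, hq1] at this

theorem eq_hahnD_of_mul_eq {q : ℂ} (hq1 : q ≠ 1) {ω : ℂ} {f g : Polynomial ℂ}
    (h : (C (q - 1) * X + C ω) * g = shiftL q ω f - f) : hahnD q ω f = g :=
  mul_left_cancel₀ (hahnD_denom_ne_zero hq1 ω) ((hahnD_spec hq1 ω f).trans h.symm)

theorem hahnD_add {q : ℂ} (hq1 : q ≠ 1) (ω : ℂ) (f g : Polynomial ℂ) :
    hahnD q ω (f + g) = hahnD q ω f + hahnD q ω g := by
  apply eq_hahnD_of_mul_eq hq1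
  rw [mul_add, hahnD_spec hq1, hahnD_spec hq1]
  simp only [shiftL, add_comp]
  ring

theorem hahnD_smul {q : ℂ} (hq1 : q ≠ 1) (ω a : ℂ) (f : Polynomial ℂ) :
    hahnD q ω (a • f) = a • hahnD q ω f := by
  apply eq_hahnD_of_mul_eq hq1
  rw [mul_smul_comm, hahnD_spec hq1]
  simp only [shiftL, smul_comp, smul_sub]

theorem hahnD_C {q : ℂ} (hq1 : q ≠ 1) (ω a : ℂ) : hahnD q ω (C a) = 0 := by
  apply eq_hahnD_of_mul_eq hq1
  simp [shiftL]

theorem hahnD_mul {q : ℂ} (hq1 : q ≠ 1) (ω : ℂ) (f g : Polynomial ℂ) :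
    hahnD q ω (f * g) = shiftL q ω f * hahnD q ω g + hahnD q ω f * g := by
  apply eq_hahnD_of_mul_eq hq1
  have hf := hahnD_spec hq1 ω f
  have hg := hahnD_spec hq1 ω g
  have hm : shiftL q ω (f * g) = shiftL q ω f * shiftL q ω g := mul_comp ..
  rw [hm]
  linear_combination shiftL q ω f * hg + g * hf

theorem shiftL_linear (q ω : ℂ) :
    shiftL q ω (C (q - 1) * X + C ω) = C q * (C (q - 1) * X + C ω) := by
  simp only [shiftL, add_comp, mul_comp, C_comp, X_comp]
  simp only [C_sub, C_1]
  ring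

theorem hahnD_shiftL {q : ℂ} (hq1 : q ≠ 1) (ω : ℂ) (f : Polynomial ℂ) :
    hahnD q ω (shiftL q ω f) = q • shiftL q ω (hahnD q ω f) := by
  apply eq_hahnD_of_mul_eq hq1
  have h := congrArg (shiftL q ω) (hahnD_spec hq1 ω f)
  have hm : shiftL q ω ((C (q - 1) * X + C ω) * hahnD q ω f) =
      shiftL q ω (C (q - 1) * X + C ω) * shiftL q ω (hahnD q ω f) := mul_comp ..
  have hs : shiftL q ω (shiftL q ω f - f) = shiftL q ω (shiftL q ω f) - shiftL q ω f :=
    sub_comp ..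
  rw [hm, hs, shiftL_linear] at h
  rw [smul_eq_C_mul]
  linear_combination h

theorem hahnD_iterate_shiftL {q : ℂ} (hq1 : q ≠ 1) (ω : ℂ) (k : ℕ) (f : Polynomial ℂ) :
    hahnD q ω ((shiftL q ω)^[k] f) = q ^ k • (shiftL q ω)^[k] (hahnD q ω f) := by
  induction k generalizing f with
  | zero => simp
  | succ k ih =>
    have hs : ∀ (a : ℂ) (g : Polynomial ℂ), shiftL q ω (a • g) = a • shiftL q ω g :=
      fun a g => smul_comp ..
    rw [Function.iterate_succ_apply', hahnD_shiftL hq1, ih, hs, smul_smul,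
      Function.iterate_succ_apply', pow_succ']

theorem shiftL_inv_shiftL {q : ℂ} (hq0 : q ≠ 0) (ω : ℂ) (f : Polynomial ℂ) :
    shiftL q⁻¹ (-ω / q) (shiftL q ω f) = f := by
  have : (C q * X + C ω).comp (C q⁻¹ * X + C (-ω / q)) = (X : Polynomial ℂ) := by
    simp only [add_comp, mul_comp, C_comp, X_comp, mul_add, ← mul_assoc, ← C_mul,
      mul_inv_cancel₀ hq0, add_assoc, ← C_add, mul_div_cancel₀ _ hq0]
    simp
  rw [shiftL, shiftL, comp_assoc, this, comp_X]

theorem hahnD_inv_shiftL {q : ℂ} (hq0 : q ≠ 0) (hq1 : q ≠ 1) (ω : ℂ) (f : Polynomial ℂ) :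
    hahnD q⁻¹ (-ω / q) (shiftL q ω f) = q • hahnD q ω f := by
  apply eq_hahnD_of_mul_eq (inv_ne_one.mpr hq1)
  rw [shiftL_inv_shiftL hq0, smul_eq_C_mul, ← neg_sub (shiftL q ω f), ← hahnD_spec hq1 ω f,
    ← mul_assoc, ← neg_mul]
  congr 1
  rw [add_mul, mul_right_comm, ← C_mul, ← C_mul, neg_add, ← neg_mul, ← C_neg, ← C_neg]
  congr 3 <;> field_simp
  ring

theorem isLinearMap_fD {q : ℂ} (hq1 : q ≠ 1) (ω : ℂ) {w : PolyFun} (hw : IsLinearMap ℂ w) :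
    IsLinearMap ℂ (fD q ω w) where
  map_add f g := by
    simp only [fD, hahnD_add (inv_ne_one.mpr hq1), hw.map_add, mul_add]
  map_smul a f := by
    simp only [fD, hahnD_smul (inv_ne_one.mpr hq1), hw.map_smul, smul_eq_mul]
    ring

theorem isLinearMap_fD_iterate {q : ℂ} (hq1 : q ≠ 1) (ω : ℂ) {w : PolyFun}
    (hw : IsLinearMap ℂ w) (k : ℕ) : IsLinearMap ℂ ((fD q ω)^[k] w) := by
  induction k with
  | zero => exact hw
  | succ k ih =>
    rw [Function.iterate_succ_apply']
    exact isLinearMap_fD hq1 ω ih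

theorem isLinearMap_pmul (g : Polynomial ℂ) {w : PolyFun} (hw : IsLinearMap ℂ w) :
    IsLinearMap ℂ (pmul g w) where
  map_add f h := by simp only [pmul, mul_add, hw.map_add]
  map_smul a f := by simp only [pmul, mul_smul_comm, hw.map_smul]

/-- The product rule for `D_{q,ω}` acting on functionals. -/
theorem fD_pmul {q : ℂ} (hq0 : q ≠ 0) (hq1 : q ≠ 1) (ω : ℂ) (g : Polynomial ℂ) {w : PolyFun}
    (hw : IsLinearMap ℂ w) :
    fD q ω (pmul g w) = pmul (shiftL q ω g) (fD q ω w) + pmul (hahnD q ω g) w := by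
  funext f
  simp only [fD, pmul, Pi.add_apply]
  rw [hahnD_mul (inv_ne_one.mpr hq1), shiftL_inv_shiftL hq0, hahnD_inv_shiftL hq0 hq1,
    hw.map_add, smul_mul_assoc, hw.map_smul, smul_eq_mul]
  field_simp
  ring

theorem fD_add {q ω : ℂ} (w z : PolyFun) : fD q ω (w + z) = fD q ω w + fD q ω z := by
  funext f
  simp [fD, mul_add]

theorem fD_smul {q ω : ℂ} (a : ℂ) (w : PolyFun) : fD q ω (a • w) = a • fD q ω w := by
  funext f
  simp [fD]
  ring

theorem fD_sum {q ω : ℂ} {ι : Type*} (s : Finset ι) (w : ι → PolyFun) :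
    fD q ω (∑ i ∈ s, w i) = ∑ i ∈ s, fD q ω (w i) := by
  funext f
  simp [fD, Finset.sum_apply, Finset.mul_sum]

theorem pmul_smul_left (a : ℂ) (g : Polynomial ℂ) {w : PolyFun} (hw : IsLinearMap ℂ w) :
    pmul (a • g) w = a • pmul g w := by
  funext f
  simp [pmul, hw.map_smul]

theorem qNum_ne_zero {q : ℂ} (hq : ∀ n : ℕ, 1 ≤ n → q ^ n ≠ 1) {n : ℕ} (hn : 1 ≤ n) :
    qNum q n ≠ 0 :=
  div_ne_zero (sub_ne_zero.mpr (hq n hn))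
    (sub_ne_zero.mpr (by simpa using hq 1 le_rfl))

theorem qFact_ne_zero {q : ℂ} (hq : ∀ n : ℕ, 1 ≤ n → q ^ n ≠ 1) (n : ℕ) : qFact q n ≠ 0 :=
  Finset.prod_ne_zero_iff.mpr fun _ _ => qNum_ne_zero hq (Nat.succ_pos _)

theorem qFact_succ (q : ℂ) (n : ℕ) : qFact q (n + 1) = qFact q n * qNum q (n + 1) :=
  Finset.prod_range_succ ..

theorem qNum_zero (q : ℂ) : qNum q 0 = 0 := by simp [qNum]

theorem qNum_add (q : ℂ) (l k : ℕ) : qNum q (l + k) = qNum q k + q ^ k * qNum q l := by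
  simp only [qNum, pow_add]
  ring

/-- The Leibniz rule for functionals, normalized by `q`-factorials. -/
theorem fD_iterate_pmul_antidiagonal {q : ℂ} (hq0 : q ≠ 0)
    (hq : ∀ n : ℕ, 1 ≤ n → q ^ n ≠ 1) (ω : ℂ) (g : Polynomial ℂ) {w : PolyFun}
    (hw : IsLinearMap ℂ w) (n : ℕ) :
    (fD q ω)^[n] (pmul g w) = qFact q n • ∑ p ∈ Finset.HasAntidiagonal.antidiagonal n,
      ((qFact q p.1)⁻¹ * (qFact q p.2)⁻¹) •
        pmul ((shiftL q ω)^[p.2] ((hahnD q ω)^[p.1] g)) ((fD q ω)^[p.2] w) := by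
  have hq1 : q ≠ 1 := by simpa using hq 1 le_rfl
  induction n with
  | zero => simp [qFact]
  | succ n ih =>
    set G : ℕ × ℕ → PolyFun := fun p => ((qFact q p.1)⁻¹ * (qFact q p.2)⁻¹) •
        pmul ((shiftL q ω)^[p.2] ((hahnD q ω)^[p.1] g)) ((fD q ω)^[p.2] w) with hG
    have hstep : ∀ p : ℕ × ℕ, fD q ω (G p) = qNum q (p.2 + 1) • G (p.1, p.2 + 1) +
        (q ^ p.2 * qNum q (p.1 + 1)) • G (p.1 + 1, p.2) := by
      rintro ⟨l, k⟩
      have hl := qFact_ne_zero hq l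
      have hk := qFact_ne_zero hq k
      have hl' := qNum_ne_zero hq (Nat.succ_pos l)
      have hk' := qNum_ne_zero hq (Nat.succ_pos k)
      simp only [Nat.succ_eq_add_one] at hl' hk'
      simp only [hG, fD_smul, fD_pmul hq0 hq1 ω _ (isLinearMap_fD_iterate hq1 ω hw k),
        hahnD_iterate_shiftL hq1, pmul_smul_left _ _ (isLinearMap_fD_iterate hq1 ω hw k),
        ← Function.iterate_succ_apply', smul_add, smul_smul, qFact_succ]
      congr 2 <;> field_simp
    have hsplit : qNum q (n + 1) • ∑ p ∈ Finset.HasAntidiagonal.antidiagonal (n + 1), G p =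
        ∑ p ∈ Finset.HasAntidiagonal.antidiagonal (n + 1), qNum q p.2 • G p +
        ∑ p ∈ Finset.HasAntidiagonal.antidiagonal (n + 1), (q ^ p.2 * qNum q p.1) • G p := by
      rw [Finset.smul_sum, ← Finset.sum_add_distrib]
      refine Finset.sum_congr rfl fun p hp => ?_
      rw [← Finset.HasAntidiagonal.mem_antidiagonal.mp hp, qNum_add, add_smul]
    rw [Function.iterate_succ_apply', ih, fD_smul, fD_sum, Finset.sum_congr rfl fun p _ => hstep p,
      Finset.sum_add_distrib, qFact_succ, mul_smul, hsplit,
      Finset.Nat.sum_antidiagonal_succ' (f := fun p => qNum q p.2 • G p),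
      Finset.Nat.sum_antidiagonal_succ (f := fun p => (q ^ p.2 * qNum q p.1) • G p)]
    simp only [qNum_zero, mul_zero, zero_smul, zero_add]

/-- The Leibniz rule for `D_{q,ω}` acting on functionals. -/
theorem fD_iterate_pmul {q : ℂ} (hq0 : q ≠ 0)
    (hq : ∀ n : ℕ, 1 ≤ n → q ^ n ≠ 1) (ω : ℂ) (g : Polynomial ℂ) {w : PolyFun}
    (hw : IsLinearMap ℂ w) (n : ℕ) :
    (fD q ω)^[n] (pmul g w) = ∑ l ∈ Finset.range (n + 1), qBinom q n l •
        pmul ((shiftL q ω)^[n - l] ((hahnD q ω)^[l] g)) ((fD q ω)^[n - l] w) := by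
  rw [fD_iterate_pmul_antidiagonal hq0 hq ω g hw n,
    Finset.Nat.sum_antidiagonal_eq_sum_range_succ_mk, Finset.smul_sum]
  refine Finset.sum_congr rfl fun l _ => ?_
  rw [smul_smul, qBinom, div_eq_mul_inv, mul_inv]

theorem coeff_shiftL {q : ℂ} (hq0 : q ≠ 0) (ω : ℂ) {f : Polynomial ℂ} {n : ℕ}
    (hf : f.natDegree ≤ n) : (shiftL q ω f).coeff n = q ^ n * f.coeff n := by
  rcases hf.lt_or_eq with h | rfl
  · have hs : (shiftL q ω f).natDegree ≤ f.natDegree := natDegree_comp_le.trans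
      ((Nat.mul_le_mul_left _ natDegree_linear_le).trans (by simp))
    rw [coeff_eq_zero_of_natDegree_lt h, coeff_eq_zero_of_natDegree_lt (hs.trans_lt h), mul_zero]
  · have h := coeff_comp_degree_mul_degree (p := f) (q := C q * X + C ω)
      (by rw [natDegree_linear hq0]; exact one_ne_zero)
    rw [natDegree_linear hq0, mul_one, leadingCoeff_linear hq0] at h
    rw [shiftL, h, mul_comm, leadingCoeff]

theorem hahnD_degree {q : ℂ} (hq0 : q ≠ 0) (hq1 : q ≠ 1) (ω : ℂ) {f : Polynomial ℂ} {n : ℕ}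
    (hf : f.natDegree ≤ n + 1) :
    (hahnD q ω f).natDegree ≤ n ∧ (hahnD q ω f).coeff n = qNum q (n + 1) * f.coeff (n + 1) := by
  have h1 : q - 1 ≠ 0 := sub_ne_zero.mpr hq1
  have hs : (shiftL q ω f).natDegree ≤ n + 1 := natDegree_comp_le.trans
    ((Nat.mul_le_mul hf natDegree_linear_le).trans (by simp))
  have hdeg : (hahnD q ω f).natDegree ≤ n := by
    by_cases h0 : hahnD q ω f = 0
    · simp [h0]
    have h := natDegree_mul (hahnD_denom_ne_zero hq1 ω) h0
    rw [hahnD_spec hq1, natDegree_linear h1] at h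
    have := (natDegree_sub_le (shiftL q ω f) f).trans (max_le hs hf)
    omega
  refine ⟨hdeg, ?_⟩
  have h := congrArg (fun p => coeff p (n + 1)) (hahnD_spec hq1 ω f)
  simp only [add_mul, mul_assoc, coeff_add, coeff_C_mul, coeff_X_mul, coeff_sub,
    coeff_shiftL hq0 ω hf, coeff_eq_zero_of_natDegree_lt (Nat.lt_succ_of_le hdeg), mul_zero,
    add_zero] at h
  rw [qNum]
  field_simp
  linear_combination h

theorem hahnD_iterate_natDegree {q : ℂ} (hq0 : q ≠ 0) (hq1 : q ≠ 1) (ω : ℂ) {n : ℕ}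
    {f : Polynomial ℂ} (hf : f.natDegree ≤ n) : (hahnD q ω)^[n] f = C (qFact q n * f.coeff n) := by
  induction n generalizing f with
  | zero => simpa [qFact] using eq_C_of_natDegree_le_zero hf
  | succ n ih =>
    obtain ⟨hd, hc⟩ := hahnD_degree hq0 hq1 ω hf
    rw [Function.iterate_succ_apply, ih hd, hc, qFact_succ, mul_assoc]

theorem hahnD_iterate_of_natDegree_lt {q : ℂ} (hq0 : q ≠ 0) (hq1 : q ≠ 1) (ω : ℂ) {n : ℕ}
    {f : Polynomial ℂ} (hf : f.natDegree < n) : (hahnD q ω)^[n] f = 0 := by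
  rw [hahnD_iterate_natDegree hq0 hq1 ω hf.le, coeff_eq_zero_of_natDegree_lt hf, mul_zero, C_0]

theorem iterate_shiftL_C (q ω a : ℂ) (k : ℕ) : (shiftL q ω)^[k] (C a) = C a :=
  Function.iterate_fixed (f := shiftL q ω) (C_comp ..) k

theorem fD_inv_iterate_apply {q : ℂ} (hq0 : q ≠ 0) (ω : ℂ) (w : PolyFun) (n : ℕ)
    (f : Polynomial ℂ) :
    (fD q⁻¹ (-ω / q))^[n] w f = (-q) ^ n * w ((hahnD q ω)^[n] f) := by
  have hω : -(-ω / q) / q⁻¹ = ω := by field_simp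
  induction n generalizing f with
  | zero => simp
  | succ n ih =>
    rw [Function.iterate_succ_apply', fD, inv_inv, hω, ih, ← Function.iterate_succ_apply,
      pow_succ']
    ring

/-- Linear functionals agreeing on a monic OPS are equal. -/
theorem IsMonicOPS.ext_functional {u : PolyFun} {P : ℕ → Polynomial ℂ} (hP : IsMonicOPS u P)
    {w z : PolyFun} (hw : IsLinearMap ℂ w) (hz : IsLinearMap ℂ z) (h : ∀ n, w (P n) = z (P n)) :
    w = z := by
  let S : Polynomial.Sequence ℂ := ⟨P, fun i => by
    rw [degree_eq_natDegree (hP.monic i).ne_zero, hP.natDegree_eq]⟩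
  have hS : Submodule.span ℂ (Set.range S) = ⊤ := S.span fun i => by
    rw [show (S i).leadingCoeff = 1 from hP.monic i]
    exact isUnit_one
  have : hw.mk' w = hz.mk' z := LinearMap.ext_on_range hS h
  exact congrArg DFunLike.coe this

/-- Duality form of the coherence relation. -/
theorem fD_iterate_pmul_eq_psiP {q ω : ℂ} (hq0 : q ≠ 0)
    (hq : ∀ n : ℕ, 1 ≤ n → q ^ n ≠ 1)
    {P Q : ℕ → Polynomial ℂ} {u v : PolyFun}
    (hu : IsMonicOPS u P) (hv : IsMonicOPS v Q)
    {piN : Polynomial ℂ} {M N m : ℕ} {c : ℕ → ℕ → ℂ}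
    (hcoh : IsCoherentPair q ω P Q piN M N m 0 c) (j : ℕ) :
    (fD q⁻¹ (-ω / q))^[m] (pmul (Q j) (pmul piN v)) =
      v (Q j ^ 2) • pmul (psiP q u P c M N m j) u := by
  have hq1 : q ≠ 1 := by simpa using hq 1 le_rfl
  let U := hu.lin.mk' u
  have hU : ∀ x, u x = U x := fun _ => rfl
  let V := hv.lin.mk' v
  have hV : ∀ x, v x = V x := fun _ => rfl
  have hpsi : ∀ n, u (psiP q u P c M N m j * P n) = ∑ i ∈ Finset.Icc (j - N) (j + M),
      (-q) ^ m * qFact q (i + m) / (qFact q i * u (P (m + i) ^ 2)) * c i j *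
        u (P (m + i) * P n) := fun n => by
    rw [psiP, Finset.sum_mul, hU, map_sum]
    simp only [← hU, smul_mul_assoc, hu.lin.map_smul, smul_eq_mul]
  have hlin := isLinearMap_fD_iterate (inv_ne_one.mpr hq1) (-ω / q)
    (isLinearMap_pmul (Q j) (isLinearMap_pmul piN hv.lin)) m
  refine hu.ext_functional hlin ?_ fun n => ?_
  · have := isLinearMap_pmul (psiP q u P c M N m j) hu.lin
    exact ⟨fun f g => by simp [this.map_add, mul_add],
      fun a f => by simp only [Pi.smul_apply, this.map_smul, smul_comm a]⟩
  rw [fD_inv_iterate_apply hq0, Pi.smul_apply, smul_eq_mul]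
  simp only [pmul]
  rw [hpsi]
  rcases lt_or_ge n m with hn | hn
  · rw [hahnD_iterate_of_natDegree_lt hq0 hq1 ω (by rwa [hu.natDegree_eq]), mul_zero, mul_zero,
      hv.lin.map_zero, mul_zero, Finset.sum_eq_zero, mul_zero]
    intro i _
    rw [hu.orth _ _ (by omega), mul_zero]
  obtain ⟨k, rfl⟩ := Nat.exists_eq_add_of_le' hn
  have hk := qFact_ne_zero hq k
  have hkm := qFact_ne_zero hq (k + m)
  have hD : (hahnD q ω)^[m] (P (k + m)) = (qFact q (k + m) / qFact q k) • dps q ω P m k := by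
    rw [dps, smul_smul, div_mul_div_cancel₀ hk, div_self hkm, one_smul]
  have hdps : ∀ i, dps q ω Q 0 i = Q i := fun i => by
    simp [dps, div_self (qFact_ne_zero hq i)]
  have hleft : v (piN * (Q j * (hahnD q ω)^[m] (P (k + m)))) =
      qFact q (k + m) / qFact q k *
        ∑ i ∈ Finset.Icc (k - M) (k + N), c k i * v (Q i * Q j) := by
    rw [hD, mul_left_comm, mul_smul_comm, mul_smul_comm, hcoh.struct, hv.lin.map_smul,
      smul_eq_mul, mul_comm (Q j), Finset.sum_mul, hV, map_sum]
    simp only [← hV, hdps, smul_mul_assoc, hv.lin.map_smul, smul_eq_mul]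
  have hmem : j ∈ Finset.Icc (k - M) (k + N) ↔ k ∈ Finset.Icc (j - N) (j + M) := by
    simp only [Finset.mem_Icc]
    omega
  rw [hleft]
  by_cases h : k ∈ Finset.Icc (j - N) (j + M)
  · rw [Finset.sum_eq_single_of_mem j (hmem.mpr h) fun i _ hi => by
        rw [hv.orth _ _ hi, mul_zero],
      Finset.sum_eq_single_of_mem k h fun i _ hi => by
        rw [hu.orth _ _ (by omega), mul_zero], add_comm m k, ← sq, ← sq]
    have := hu.sq_ne (k + m)
    field_simp
  · rw [Finset.sum_eq_zero fun i hi => ?_, Finset.sum_eq_zero fun i hi => ?_]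
    · simp
    · rw [hu.orth _ _ (fun he => h (by rwa [show k = i by omega])), mul_zero]
    · rw [hv.orth _ _ (fun he => h (hmem.mp (by rwa [← he]))), mul_zero]

/-- **Theorem 2.4 (case k = 0), second part.** For every `j = 0,…,m` one has
`D_{1/q,−ω/q}^{m−j}(π_N·v) = Φ(·;j)·u`; in particular `π_N·v = Φ(·;m)·u`, so
that `u` and `v` are related by a rational transformation. -/
theorem coherent_pair_k_zero_rational (q ω : ℂ) (hq0 : q ≠ 0)
    (hq : ∀ n : ℕ, 1 ≤ n → q ^ n ≠ 1)
    (P Q : ℕ → Polynomial ℂ) (u v : PolyFun)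
    (hu : IsMonicOPS u P) (hv : IsMonicOPS v Q)
    (piN : Polynomial ℂ) (M N m : ℕ) (c : ℕ → ℕ → ℂ)
    (hcoh : IsCoherentPair q ω P Q piN M N m 0 c)
    (hm : N = 0 → 1 ≤ m)
    (Φ : ℕ → Polynomial ℂ)
    (hΦ : ∀ j, Φ j = (qFact q⁻¹ j * qBinom q⁻¹ m j)⁻¹ •
      (v (Q j ^ 2) • psiP q u P c M N m j -
        ∑ l ∈ Finset.range j, qBinom q⁻¹ m l •
          ((shiftL q⁻¹ (-ω / q))^[m - l] ((hahnD q⁻¹ (-ω / q))^[l] (Q j)) * Φ l))) :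
    (∀ j, j ≤ m → (fD q⁻¹ (-ω / q))^[m - j] (pmul piN v) = pmul (Φ j) u) ∧
    pmul piN v = pmul (Φ m) u := by
  have hp : ∀ n : ℕ, 1 ≤ n → q⁻¹ ^ n ≠ 1 := fun n hn h =>
    hq n hn (by rwa [inv_pow, inv_eq_one] at h)
  have hp1 : q⁻¹ ≠ 1 := by simpa using hp 1 le_rfl
  have hw := isLinearMap_pmul piN hv.lin
  have key : ∀ j, j ≤ m → (fD q⁻¹ (-ω / q))^[m - j] (pmul piN v) = pmul (Φ j) u := by
    intro j
    induction j using Nat.strong_induction_on with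
    | _ j ih =>
      intro hj
      have hL := fD_iterate_pmul (inv_ne_zero hq0) hp (-ω / q) (Q j) hw m
      rw [fD_iterate_pmul_eq_psiP hq0 hq hu hv hcoh j,
        ← Finset.sum_subset (Finset.range_subset_range.mpr (Nat.succ_le_succ hj)) ?_,
        Finset.sum_range_succ, hahnD_iterate_natDegree (inv_ne_zero hq0) hp1 _
          (hv.natDegree_eq j).le] at hL
      · have hc : (Q j).coeff j = 1 := by
          simpa [hv.natDegree_eq j] using (hv.monic j).coeff_natDegree
        have hne : qFact q⁻¹ j * qBinom q⁻¹ m j ≠ 0 :=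
          mul_ne_zero (qFact_ne_zero hp j) (div_ne_zero (qFact_ne_zero hp m)
            (mul_ne_zero (qFact_ne_zero hp _) (qFact_ne_zero hp _)))
        funext f
        have hf := congrFun hL f
        rw [hc, mul_one, iterate_shiftL_C] at hf
        have hsum : ∀ l ∈ Finset.range j, (qBinom q⁻¹ m l •
            pmul ((shiftL q⁻¹ (-ω / q))^[m - l] ((hahnD q⁻¹ (-ω / q))^[l] (Q j)))
              ((fD q⁻¹ (-ω / q))^[m - l] (pmul piN v))) f =
            u (qBinom q⁻¹ m l • ((shiftL q⁻¹ (-ω / q))^[m - l]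
              ((hahnD q⁻¹ (-ω / q))^[l] (Q j)) * Φ l) * f) := by
          intro l hl
          have hlj := Finset.mem_range.mp hl
          rw [ih l hlj (hlj.le.trans hj), smul_mul_assoc, hu.lin.map_smul]
          simp only [Pi.smul_apply, pmul]
          congr 2
          ring
        rw [Pi.add_apply, Finset.sum_apply, Finset.sum_congr rfl hsum] at hf
        have hlin := isLinearMap_fD_iterate hp1 (-ω / q) hw (m - j)
        simp only [Pi.smul_apply, pmul, ← smul_eq_C_mul] at hf
        rw [hlin.map_smul] at hf
        have hsub : ∀ (x : Polynomial ℂ) (y : ℕ → Polynomial ℂ),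
            u (x - ∑ l ∈ Finset.range j, y l) = u x - ∑ l ∈ Finset.range j, u (y l) :=
          fun x y => by rw [hu.lin.map_sub]; exact congrArg _ (map_sum (hu.lin.mk' u) y _)
        rw [hΦ j, pmul_smul_left _ _ hu.lin, Pi.smul_apply, eq_inv_smul_iff₀ hne, pmul,
          sub_mul, Finset.sum_mul, hsub, smul_mul_assoc, hu.lin.map_smul, hf,
          add_sub_cancel_left, smul_smul, mul_comm (qFact q⁻¹ j)]
      · intro l _ hl
        rw [hahnD_iterate_of_natDegree_lt (inv_ne_zero hq0) hp1]
        · funext f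
          have := iterate_shiftL_C q⁻¹ (-ω / q) 0 (m - l)
          rw [C_0] at this
          simp [this, pmul, (isLinearMap_fD_iterate hp1 (-ω / q) hw (m - l)).map_zero]
        · rw [hv.natDegree_eq]
          have := Finset.mem_range.not.mp hl
          omega
  exact ⟨key, by simpa using key m le_rfl⟩

end DiscreteCoherent
end
end

section
/- Let (P_n)_{n≥0} be the monic OPS with respect to a regular functional u, satisfying the three-term recurrence xP_n = P_{n+1} + β_n P_n + γ_n P_{n−1} with γ_n ≠ 0, and suppose D_{q,ω} P_{n+1} = [n+1]_q P_n for all n ≥ 0. Then u satisfies the functional equation D_{1/q,−ω/q} u = −(q/γ₁)(x − β₀)·u. -/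
open Polynomial Finset

noncomputable section

namespace DiscreteCoherent

theorem add_divByMonic {p : Polynomial ℂ} (hp : p.Monic) (f g : Polynomial ℂ) :
    (f + g) /ₘ p = f /ₘ p + g /ₘ p := by
  apply mul_left_cancel₀ hp.ne_zero
  linear_combination modByMonic_add_div (f + g) p - modByMonic_add_div f p -
    modByMonic_add_div g p - add_modByMonic (q := p) f g

theorem smul_divByMonic {p : Polynomial ℂ} (hp : p.Monic) (c : ℂ) (f : Polynomial ℂ) :
    (c • f) /ₘ p = c • (f /ₘ p) := by
  apply mul_left_cancel₀ hp.ne_zero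
  have h := smul_modByMonic (q := p) c f
  have h' := modByMonic_add_div (c • f) p
  simp only [smul_eq_C_mul] at h h' ⊢
  linear_combination h' - C c * modByMonic_add_div f p - h

/-- The Hahn operator as a linear map. -/
def hahnDLinear (q ω : ℂ) : Polynomial ℂ →ₗ[ℂ] Polynomial ℂ where
  toFun := hahnD q ω
  map_add' f g := by
    simp only [hahnD, add_comp, add_sub_add_comm, add_divByMonic (monic_X_sub_C _), smul_add]
  map_smul' c f := by
    simp only [hahnD, smul_comp, ← smul_sub, smul_divByMonic (monic_X_sub_C _), RingHom.id_apply]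
    rw [smul_comm]

theorem hahnD_one (q ω : ℂ) : hahnD q ω 1 = 0 := by
  simp [hahnD]

/-- Linear maps on polynomials agree if they agree on a sequence of monic polynomials
having one member in each degree. -/
theorem linearMap_ext_monic {P : ℕ → Polynomial ℂ} (hP : ∀ n, (P n).Monic)
    (hdeg : ∀ n, (P n).natDegree = n) {F G : Polynomial ℂ →ₗ[ℂ] ℂ}
    (h : ∀ n, F (P n) = G (P n)) : F = G := by
  let S : Polynomial.Sequence ℂ :=
    ⟨P, fun n => by rw [degree_eq_natDegree (hP n).ne_zero, hdeg]⟩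
  refine LinearMap.ext_on_range (v := P) (S.span fun n => ?_) h
  change IsUnit (P n).leadingCoeff
  simp [(hP n).leadingCoeff]

theorem IsMonicOPS.eq_one {u : PolyFun} {P : ℕ → Polynomial ℂ} (hu : IsMonicOPS u P) :
    P 0 = 1 :=
  (hu.monic 0).natDegree_eq_zero.mp (hu.natDegree_eq 0)

/-- The functional of a monic OPS vanishes on the members of positive degree. -/
theorem IsMonicOPS.map_succ {u : PolyFun} {P : ℕ → Polynomial ℂ} (hu : IsMonicOPS u P)
    (n : ℕ) : u (P (n + 1)) = 0 := by
  simpa [hu.eq_one] using hu.orth (n + 1) 0 n.succ_ne_zero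

/-- The first recurrence coefficient `γ₁` is the ratio of the first two squared norms. -/
theorem IsMonicOPS.map_one_mul_one {u : PolyFun} {P : ℕ → Polynomial ℂ}
    (hu : IsMonicOPS u P) {b b' c : ℂ} (h0 : X * P 0 = P 1 + C b * P 0)
    (h1 : X * P 1 = P 2 + C b' * P 1 + C c * P 0) :
    u (P 1 * P 1) = c * u 1 := by
  have h0' : X = P 1 + C b := by simpa [hu.eq_one] using h0
  have key : P 1 * P 1 = P 2 + (b' - b) • P 1 + c • 1 := by
    simp only [smul_eq_C_mul, C_sub]
    rw [hu.eq_one] at h1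
    linear_combination h1 - P 1 * h0'
  rw [key, hu.lin.map_add, hu.lin.map_add, hu.lin.map_smul, hu.lin.map_smul,
    hu.map_succ 1, hu.map_succ 0]
  simp

/-- **Case N = 0 of Theorem 3.1 (functional equation).** If the monic OPS
`(P_n)` with respect to the regular functional `u` satisfies
`D_{q,ω} P_{n+1} = [n+1]_q P_n`, then `D_{1/q,−ω/q} u = −(q/γ₁)(x − β₀)·u`. -/
theorem appell_functional_equation (q ω : ℂ) (hq0 : q ≠ 0)
    (hq : ∀ n : ℕ, 1 ≤ n → q ^ n ≠ 1)
    (u : PolyFun) (P : ℕ → Polynomial ℂ) (hu : IsMonicOPS u P)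
    (β γ : ℕ → ℂ) (hγ : ∀ n, 1 ≤ n → γ n ≠ 0)
    (hrec0 : X * P 0 = P 1 + C (β 0) * P 0)
    (hrec : ∀ n, X * P (n + 1) = P (n + 2) + C (β (n + 1)) * P (n + 1) + C (γ (n + 1)) * P n)
    (hD : ∀ n, hahnD q ω (P (n + 1)) = qNum q (n + 1) • P n) :
    fD q⁻¹ (-ω / q) u = pmul ((-(q / γ 1)) • (X - C (β 0))) u := by
  have hq1 : q - 1 ≠ 0 := sub_ne_zero.mpr (by simpa using hq 1 le_rfl)
  have hX : X - C (β 0) = P 1 := by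
    have h : X = P 1 + C (β 0) := by simpa [hu.eq_one] using hrec0
    linear_combination h
  let U : Polynomial ℂ →ₗ[ℂ] ℂ := hu.lin.mk' u
  have key : γ 1 • U ∘ₗ hahnDLinear q ω = U ∘ₗ LinearMap.mulLeft ℂ (P 1) := by
    refine linearMap_ext_monic hu.monic hu.natDegree_eq fun n => ?_
    change γ 1 * u (hahnD q ω (P n)) = u (P 1 * P n)
    rcases n with _ | _ | n
    · rw [hu.orth 1 0 one_ne_zero, hu.eq_one, hahnD_one, hu.lin.map_zero, mul_zero]
    · rw [hD, zero_add, hu.map_one_mul_one hrec0 (hrec 0), hu.eq_one]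
      simp [qNum, div_self hq1]
    · rw [hD, hu.lin.map_smul, hu.map_succ, hu.orth 1 (n + 2) (by lia), smul_zero, mul_zero]
  funext f
  have hf : γ 1 * u (hahnD q ω f) = u (P 1 * f) := LinearMap.congr_fun key f
  have hω : -(-ω / q) / q⁻¹ = ω := by field_simp
  have hγ1 := hγ 1 le_rfl
  simp only [fD, pmul]
  rw [inv_inv, hω, hX, smul_mul_assoc, hu.lin.map_smul, ← hf, smul_eq_mul]
  field_simp

end DiscreteCoherent
end
end

section
/- Let (P_n)_{n≥0} be a monic OPS with respect to a regular functional u, satisfying the three-term recurrence xP_n = P_{n+1} + β_n P_n + γ_n P_{n−1}, and suppose D_{q,ω} P_{n+1} = [n+1]_q P_n for all n ≥ 0. Set ω₀ = ω/(1−q) and let a, b be the two roots of z² + (ω₀ − β₀)z + γ₁/(q−1) = 0. Then ab ≠ 0, and for all n ≥ 0 one has β_n = ω₀ + (a+b)q^n and γ_{n+1} = −ab(1−q^{n+1})q^n; equivalently, P_n(x) = L_n(x − ω₀; a, b, 0 | q) for all n ≥ 0. -/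
open Polynomial Finset

noncomputable section

namespace DiscreteCoherent

/-- The monic polynomial sequence determined by a three-term recurrence
`x R_n = R_{n+1} + β_n R_n + γ_n R_{n−1}` with `R_{−1} = 0`, `R_0 = 1`. -/
def ttrSeq (β γ : ℕ → ℂ) : ℕ → Polynomial ℂ
  | 0 => 1
  | 1 => X - C (β 0)
  | n + 2 => (X - C (β (n + 1))) * ttrSeq β γ (n + 1) - C (γ (n + 1)) * ttrSeq β γ n

/-- Recurrence coefficient `β_n` for `L_n(·;a,b,c|q)`. -/
def Lbeta (q a b c : ℂ) (n : ℕ) : ℂ := (a + b - c * (q ^ (n + 1) + q ^ n - 1)) * q ^ n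

/-- Recurrence coefficient `γ_n` for `L_n(·;a,b,c|q)`:
`γ_{n+1} = −(a − cq^{n+1})(b − cq^{n+1})(1 − q^{n+1})q^n`. -/
def Lgamma (q a b c : ℂ) (n : ℕ) : ℂ :=
  -((a - c * q ^ n) * (b - c * q ^ n) * (1 - q ^ n) * q ^ (n - 1))

/-- The monic OPS `(L_n(·;a,b,c|q))_{n≥0}`. -/
def Lpoly (q a b c : ℂ) : ℕ → Polynomial ℂ := ttrSeq (Lbeta q a b c) (Lgamma q a b c)

/-- Recurrence coefficient `β_n` for `J_n(·;a,b,c,d|q)`. -/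
def Jbeta (q a b c d : ℂ) (n : ℕ) : ℂ :=
  q ^ n * ((a * (b + d) + c * (b + 1)) * (1 + d * q ^ (2 * n + 1)) -
      (c * (b + d) + a * d * (b + 1)) * (1 + q) * q ^ n) /
    ((1 - d * q ^ (2 * n)) * (1 - d * q ^ (2 * n + 2)))

/-- Recurrence coefficient `γ_n` for `J_n(·;a,b,c,d|q)`:
`γ_{n+1} = −q^n(1−q^{n+1})(1−bq^{n+1})(1−dq^{n+1})(a−cq^{n+1})(b−dq^{n+1})(c−adq^{n+1}) /
((1−dq^{2n+1})(1−dq^{2n+2})²(1−dq^{2n+3}))`. -/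
def Jgamma (q a b c d : ℂ) (n : ℕ) : ℂ :=
  -(q ^ (n - 1) * (1 - q ^ n) * (1 - b * q ^ n) * (1 - d * q ^ n) * (a - c * q ^ n) *
      (b - d * q ^ n) * (c - a * d * q ^ n)) /
    ((1 - d * q ^ (2 * n - 1)) * (1 - d * q ^ (2 * n)) ^ 2 * (1 - d * q ^ (2 * n + 1)))

/-- The monic OPS `(J_n(·;a,b,c,d|q))_{n≥0}`. -/
def Jpoly (q a b c d : ℂ) : ℕ → Polynomial ℂ := ttrSeq (Jbeta q a b c d) (Jgamma q a b c d)

end DiscreteCoherent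
namespace DiscreteCoherent

theorem X_sub_C_mul_hahnD {q : ℂ} (hq1 : q ≠ 1) (ω : ℂ) (f : Polynomial ℂ) :
    C (q - 1) * ((X - C (ω / (1 - q))) * hahnD q ω f) = f.comp (C q * X + C ω) - f := by
  have h1 : q - 1 ≠ 0 := sub_ne_zero.mpr hq1
  have h2 : 1 - q ≠ 0 := sub_ne_zero.mpr hq1.symm
  have hfix : q * (ω / (1 - q)) + ω = ω / (1 - q) := by
    field_simp
    ring
  have hroot : (f.comp (C q * X + C ω) - f).IsRoot (ω / (1 - q)) := by
    simp [IsRoot, eval_comp, hfix]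
  have hdiv := mul_divByMonic_eq_iff_isRoot.mpr hroot
  rw [hahnD, mul_smul_comm, hdiv, ← smul_eq_C_mul, smul_smul, mul_inv_cancel₀ h1, one_smul]

theorem eq_zero_of_C_mul_add_C_mul_eq_zero {p r : Polynomial ℂ} (hp : p.Monic) (hr : r.Monic)
    (hdeg : r.natDegree < p.natDegree) {c d : ℂ} (h : C c * p + C d * r = 0) :
    c = 0 ∧ d = 0 := by
  have hc : c = 0 := by
    have := congrArg (fun s => coeff s p.natDegree) h
    simpa [coeff_eq_zero_of_natDegree_lt hdeg, hp.coeff_natDegree] using this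
  subst hc
  have := congrArg (fun s => coeff s r.natDegree) h
  exact ⟨rfl, by simpa [hr.coeff_natDegree] using this⟩

/-- **Case N = 0 of Theorem 3.1 (classification).** If the monic OPS `(P_n)`
with respect to `u` satisfies `D_{q,ω} P_{n+1} = [n+1]_q P_n`, and `a`, `b` are
the two roots of `z² + (ω₀ − β₀)z + γ₁/(q−1) = 0` where `ω₀ = ω/(1−q)`, then
`ab ≠ 0`, `β_n = ω₀ + (a+b)q^n`, `γ_{n+1} = −ab(1−q^{n+1})q^n`, i.e.
`P_n(x) = L_n(x − ω₀; a, b, 0 | q)`. -/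
theorem appell_classification (q ω : ℂ) (hq0 : q ≠ 0)
    (hq : ∀ n : ℕ, 1 ≤ n → q ^ n ≠ 1)
    (u : PolyFun) (P : ℕ → Polynomial ℂ) (hu : IsMonicOPS u P)
    (β γ : ℕ → ℂ) (hγ : ∀ n, 1 ≤ n → γ n ≠ 0)
    (hrec0 : X * P 0 = P 1 + C (β 0) * P 0)
    (hrec : ∀ n, X * P (n + 1) = P (n + 2) + C (β (n + 1)) * P (n + 1) + C (γ (n + 1)) * P n)
    (hD : ∀ n, hahnD q ω (P (n + 1)) = qNum q (n + 1) • P n)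
    (ω₀ : ℂ) (hω₀ : ω₀ = ω / (1 - q)) (a b : ℂ)
    (hroots : ∀ z : ℂ, z ^ 2 + (ω₀ - β 0) * z + γ 1 / (q - 1) = (z - a) * (z - b)) :
    a * b ≠ 0 ∧
    (∀ n, β n = ω₀ + (a + b) * q ^ n) ∧
    (∀ n, γ (n + 1) = -(a * b) * (1 - q ^ (n + 1)) * q ^ n) ∧
    (∀ n, P n = (Lpoly q a b 0 n).comp (X - C ω₀)) := by
  have hq1 : q ≠ 1 := by simpa using hq 1 le_rfl
  have h1 : q - 1 ≠ 0 := sub_ne_zero.mpr hq1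
  have h1' : 1 - q ≠ 0 := sub_ne_zero.mpr hq1.symm
  have hω : ω = ω₀ * (1 - q) := by rw [hω₀]; field_simp
  have hP0 : P 0 = 1 := (hu.monic 0).natDegree_eq_zero.mp (hu.natDegree_eq 0)
  have hsum : a + b = β 0 - ω₀ := by linear_combination hroots 1 - hroots 0
  have hprod : a * b * (q - 1) = γ 1 := by
    have h := hroots 0
    field_simp at h
    linear_combination -h
  have hY : (X - C ω₀ : Polynomial ℂ) ≠ 0 := X_sub_C_ne_zero ω₀
  have hS (n : ℕ) : (P (n + 1)).comp (C q * X + C ω) =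
      P (n + 1) + (C q ^ (n + 1) - 1) * (X - C ω₀) * P n := by
    have h := X_sub_C_mul_hahnD hq1 ω (P (n + 1))
    have hnum : C (q - 1) * C (qNum q (n + 1)) = (C q ^ (n + 1) - 1 : Polynomial ℂ) := by
      rw [← C_mul, qNum, mul_div_cancel₀ _ h1]
      simp
    rw [hD, ← hω₀, smul_eq_C_mul] at h
    linear_combination -h + (X - C ω₀) * P n * hnum
  have hCω : (C ω : Polynomial ℂ) = C ω₀ * (1 - C q) := by rw [hω]; simp
  have hcomp (n : ℕ) := congrArg (fun s => s.comp (C q * X + C ω)) (hrec n)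
  simp only [add_comp, mul_comp, X_comp, C_comp] at hcomp
  have hβ0 : β 1 = q * β 0 + ω₀ * (1 - q) := by
    have h := hcomp 0
    rw [hS 0, hS 1, hP0, one_comp] at h
    have hr0 := hrec0
    have hr := hrec 0
    rw [hP0] at hr hr0
    have hz : (X - C ω₀) * (C ((q - 1) * (q * β 0 + ω₀ * (1 - q) - β 1)) : Polynomial ℂ) = 0 := by
      simp only [C_mul, C_sub, C_add, C_1]
      rw [hCω] at h
      simp only [zero_add] at *
      linear_combination h - hr - C q * (C q - 1) * (X - C ω₀) * hr0
    have hz' := C_eq_zero.mp ((mul_eq_zero.mp hz).resolve_left hY)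
    linear_combination -(mul_eq_zero.mp hz').resolve_left h1
  have hstep (n : ℕ) : β (n + 2) = q * β (n + 1) + ω₀ * (1 - q) ∧
      γ (n + 2) * (q ^ (n + 1) - 1) = q * γ (n + 1) * (q ^ (n + 2) - 1) := by
    have h := hcomp (n + 1)
    rw [hS (n + 1), hS (n + 2), hS n, hCω] at h
    have hz : (X - C ω₀) *
        (C ((q ^ (n + 2) - 1) * (q * β (n + 1) + ω₀ * (1 - q) - β (n + 2))) * P (n + 1) +
          C (q * γ (n + 1) * (q ^ (n + 2) - 1) - γ (n + 2) * (q ^ (n + 1) - 1)) * P n) = 0 := by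
      simp only [C_mul, C_sub, C_add, C_1, C_pow]
      linear_combination h - hrec (n + 1) -
        C q * (C q ^ (n + 2) - 1) * (X - C ω₀) * hrec n
    obtain ⟨hc, hd⟩ := eq_zero_of_C_mul_add_C_mul_eq_zero (hu.monic (n + 1)) (hu.monic n)
      (by simp [hu.natDegree_eq]) ((mul_eq_zero.mp hz).resolve_left hY)
    have hn : q ^ (n + 2) - 1 ≠ 0 := sub_ne_zero.mpr (hq _ (by omega))
    exact ⟨by linear_combination -(mul_eq_zero.mp hc).resolve_left hn, by linear_combination -hd⟩
  have hβ (n : ℕ) : β n = ω₀ + (a + b) * q ^ n := by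
    induction n with
    | zero => rw [hsum]; ring
    | succ n ih =>
      have h : β (n + 1) = q * β n + ω₀ * (1 - q) := by
        cases n with
        | zero => exact hβ0
        | succ n => exact (hstep n).1
      rw [h, ih]
      ring
  have hγ' (n : ℕ) : γ (n + 1) = -(a * b) * (1 - q ^ (n + 1)) * q ^ n := by
    induction n with
    | zero => rw [zero_add, ← hprod]; ring
    | succ n ih =>
      have h := (hstep n).2
      rw [ih] at h
      apply mul_right_cancel₀ (sub_ne_zero.mpr (hq (n + 1) (by omega)))
      rw [h]
      ring
  refine ⟨fun hab => hγ 1 le_rfl (by rw [← hprod, hab, zero_mul]), hβ, hγ', fun n => ?_⟩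
  induction n using Nat.twoStepInduction with
  | zero => simp [Lpoly, ttrSeq, hP0]
  | one =>
    have h := hrec0
    rw [hP0, hβ] at h
    simp only [Lpoly, ttrSeq, Lbeta, sub_comp, X_comp, C_comp]
    simp only [C_add, C_mul, C_pow, C_sub, C_0] at h ⊢
    linear_combination -h
  | more n ih0 ih1 =>
    have h := hrec n
    rw [hβ, hγ'] at h
    simp only [Lpoly] at ih0 ih1 ⊢
    rw [ttrSeq]
    simp only [sub_comp, mul_comp, X_comp, C_comp]
    rw [← ih0, ← ih1]
    simp only [Lbeta, Lgamma, Nat.add_sub_cancel]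
    simp only [C_add, C_mul, C_pow, C_sub, C_neg, C_0, C_1] at h ⊢
    linear_combination -h

end DiscreteCoherent
end
end

section
/- Let a, b, c ∈ ℂ with bc ≠ 0 and a ≠ cq^n, b ≠ cq^n for all integers n ≥ 1. Then L_n(x; a, b, c | q) = J_n(x; ab/c, c/b, b, 0 | q) for all n ≥ 0. Similarly, if ac ≠ 0 and a ≠ cq^n, b ≠ cq^n for all n ≥ 1, then L_n(x; a, b, c | q) = J_n(x; ab/c, c/a, a, 0 | q) for all n ≥ 0. -/
open Polynomial Finset

noncomputable section

namespace DiscreteCoherent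

theorem Lpoly_swap (q a b c : ℂ) : Lpoly q a b c = Lpoly q b a c := by
  have hβ : Lbeta q a b c = Lbeta q b a c := by
    funext n
    simp only [Lbeta]
    ring
  have hγ : Lgamma q a b c = Lgamma q b a c := by
    funext n
    simp only [Lgamma]
    ring
  simp only [Lpoly, hβ, hγ]

theorem Lpoly_eq_Jpoly_of_ne_zero (q a : ℂ) {b c : ℂ} (hb : b ≠ 0) (hc : c ≠ 0) :
    Lpoly q a b c = Jpoly q (a * b / c) (c / b) b 0 := by
  have hβ : Lbeta q a b c = Jbeta q (a * b / c) (c / b) b 0 := by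
    funext n
    simp only [Lbeta, Jbeta, zero_mul, mul_zero, add_zero, sub_zero, mul_one, div_one]
    field_simp
    ring
  have hγ : Lgamma q a b c = Jgamma q (a * b / c) (c / b) b 0 := by
    funext n
    simp only [Lgamma, Jgamma, zero_mul, mul_zero, sub_zero, mul_one, one_pow, div_one]
    field_simp
  simp only [Lpoly, Jpoly, hβ, hγ]

/-- `L_n(x;a,b,c|q) = J_n(x;ab/c,c/b,b,0|q)` if `bc ≠ 0`, and
`L_n(x;a,b,c|q) = J_n(x;ab/c,c/a,a,0|q)` if `ac ≠ 0`, under the regularity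
conditions `a ≠ cq^n`, `b ≠ cq^n` for all `n ≥ 1`. -/
theorem Lpoly_eq_Jpoly (q : ℂ) (hq0 : q ≠ 0) (hq : ∀ n : ℕ, 1 ≤ n → q ^ n ≠ 1)
    (a b c : ℂ) (hreg : ∀ n : ℕ, 1 ≤ n → a ≠ c * q ^ n ∧ b ≠ c * q ^ n) :
    (b * c ≠ 0 → ∀ n, Lpoly q a b c n = Jpoly q (a * b / c) (c / b) b 0 n) ∧
    (a * c ≠ 0 → ∀ n, Lpoly q a b c n = Jpoly q (a * b / c) (c / a) a 0 n) := by
  refine ⟨fun h n => ?_, fun h n => ?_⟩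
  · rw [Lpoly_eq_Jpoly_of_ne_zero q a (left_ne_zero_of_mul h) (right_ne_zero_of_mul h)]
  · rw [Lpoly_swap, mul_comm a b,
      Lpoly_eq_Jpoly_of_ne_zero q b (left_ne_zero_of_mul h) (right_ne_zero_of_mul h)]

end DiscreteCoherent
end
end
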